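/- For all integers k ≥ 2 and ℓ ≥ 18k² + 40k − 57 there exists a k-fan-crossing-free simple graph G with exactly n = 9kℓ + 27ℓ + 3k + 10 vertices such that cr_{k-fan-free}(G) ≥ ℓ² and cr(G) ≤ k (hence the k-fan-crossing-free crossing ratio is Ω(n²/k³)). -/

import Mathlib

open Set

noncomputable section

/-- A drawing of a simple graph in the plane: vertices are mapped to distinct
points, each edge `uv` is drawn as a simple arc joining the images of `u` and
`v` and avoiding the images of the other vertices, any two arcs meet in
finitely many points, and no three arcs pass through a common non-vertex
point. -/
structure Drawing {V : Type} (G : SimpleGraph V) where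
  vpos : V → ℝ × ℝ
  vpos_inj : Function.Injective vpos
  arc : V → V → ℝ → ℝ × ℝ
  arc_symm : ∀ u v t, arc u v t = arc v u (1 - t)
  arc_cont : ∀ u v, G.Adj u v → ContinuousOn (arc u v) (Set.Icc 0 1)
  arc_injOn : ∀ u v, G.Adj u v → Set.InjOn (arc u v) (Set.Icc 0 1)
  arc_start : ∀ u v, G.Adj u v → arc u v 0 = vpos u
  arc_end : ∀ u v, G.Adj u v → arc u v 1 = vpos v
  arc_avoids : ∀ u v, G.Adj u v → ∀ t ∈ Set.Ioo (0:ℝ) 1, arc u v t ∉ Set.range vpos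
  inter_finite : ∀ u v w z, G.Adj u v → G.Adj w z → s(u, v) ≠ s(w, z) →
    ((arc u v '' Set.Icc 0 1) ∩ (arc w z '' Set.Icc 0 1)).Finite
  no_triple_point : ∀ p : ℝ × ℝ, p ∉ Set.range vpos →
    ∀ u₁ v₁ u₂ v₂ u₃ v₃, G.Adj u₁ v₁ → G.Adj u₂ v₂ → G.Adj u₃ v₃ →
      s(u₁, v₁) ≠ s(u₂, v₂) → s(u₁, v₁) ≠ s(u₃, v₃) → s(u₂, v₂) ≠ s(u₃, v₃) →
      ¬ (p ∈ arc u₁ v₁ '' Set.Icc 0 1 ∧ p ∈ arc u₂ v₂ '' Set.Icc 0 1 ∧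
          p ∈ arc u₃ v₃ '' Set.Icc 0 1)

namespace Drawing

variable {V : Type} {G : SimpleGraph V}

lemma img_symm_aux (Γ : Drawing G) (u v : V) :
    Γ.arc u v '' Set.Icc 0 1 = Γ.arc v u '' Set.Icc 0 1 := by
  have key : ∀ a b : V, Γ.arc a b '' Set.Icc 0 1 ⊆ Γ.arc b a '' Set.Icc 0 1 := by
    rintro a b p ⟨t, ht, rfl⟩
    refine ⟨1 - t, ⟨by linarith [ht.2], by linarith [ht.1]⟩, ?_⟩
    rw [Γ.arc_symm b a (1 - t)]
    congr 1
    ring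
  exact Set.Subset.antisymm (key u v) (key v u)

/-- The image (trace) of an edge in the drawing. -/
def img (Γ : Drawing G) (e : Sym2 V) : Set (ℝ × ℝ) :=
  Sym2.lift ⟨fun u v => Γ.arc u v '' Set.Icc 0 1, fun u v => Γ.img_symm_aux u v⟩ e

/-- `p` is a crossing point of the two distinct edges `e` and `f` : it lies on
both arcs and is not the image of a vertex (so it is not a shared endpoint). -/
def Crossing (Γ : Drawing G) (e f : Sym2 V) (p : ℝ × ℝ) : Prop :=
  e ∈ G.edgeSet ∧ f ∈ G.edgeSet ∧ e ≠ f ∧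
    p ∈ Γ.img e ∧ p ∈ Γ.img f ∧ p ∉ Set.range Γ.vpos

/-- The edges `e` and `f` cross in the drawing. -/
def Crosses (Γ : Drawing G) (e f : Sym2 V) : Prop := ∃ p, Γ.Crossing e f p

/-- The set of crossing points of a drawing. -/
def crossingSet (Γ : Drawing G) : Set (ℝ × ℝ) := {p | ∃ e f, Γ.Crossing e f p}

/-- The number of crossings of a drawing. -/
def crossings (Γ : Drawing G) : ℕ := Γ.crossingSet.ncard

/-- The set of crossing points lying on a given edge. -/
def edgeCrossings (Γ : Drawing G) (e : Sym2 V) : Set (ℝ × ℝ) :=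
  {p | ∃ f, Γ.Crossing e f p}

/-- A drawing is `k`-planar if every edge is involved in at most `k` crossings. -/
def IsKPlanar (Γ : Drawing G) (k : ℕ) : Prop :=
  ∀ e ∈ G.edgeSet, (Γ.edgeCrossings e).ncard ≤ k

/-- A drawing is `k`-gap-planar if each crossing can be assigned to one of its
two involved edges such that every edge is assigned at most `k` crossings. -/
def IsKGapPlanar (Γ : Drawing G) (k : ℕ) : Prop :=
  ∃ assign : ℝ × ℝ → Sym2 V,
    (∀ p ∈ Γ.crossingSet, ∃ f, Γ.Crossing (assign p) f p) ∧
    ∀ e : Sym2 V, {p | p ∈ Γ.crossingSet ∧ assign p = e}.ncard ≤ k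

/-- A drawing is skewness-`k` if there is a set of at most `k` edges such that
every crossing involves an edge from the set. -/
def IsSkewness (Γ : Drawing G) (k : ℕ) : Prop :=
  ∃ S : Finset (Sym2 V), S.card ≤ k ∧
    ∀ p ∈ Γ.crossingSet, ∃ e ∈ S, ∃ f, Γ.Crossing e f p

/-- A drawing is `k`-apex if there is a set of at most `k` vertices such that
every crossing involves an edge incident to one of these vertices. -/
def IsKApex (Γ : Drawing G) (k : ℕ) : Prop :=
  ∃ S : Finset V, S.card ≤ k ∧
    ∀ p ∈ Γ.crossingSet, ∃ e f, Γ.Crossing e f p ∧ ∃ a ∈ S, a ∈ e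

/-- A drawing is `(k,l)`-grid-free if there is no set of `k` edges each of
which crosses each edge of some set of `l` edges. -/
def IsGridFree (Γ : Drawing G) (k l : ℕ) : Prop :=
  ¬ ∃ A B : Finset (Sym2 V), A.card = k ∧ B.card = l ∧
      ∀ e ∈ A, ∀ f ∈ B, Γ.Crosses e f

/-- A drawing is `k`-fan-crossing-free if no edge crosses `k` edges that all
share a common endpoint. -/
def IsKFanCrossingFree (Γ : Drawing G) (k : ℕ) : Prop :=
  ¬ ∃ (e : Sym2 V) (a : V) (F : Finset (Sym2 V)), F.card = k ∧
      ∀ f ∈ F, a ∈ f ∧ Γ.Crosses e f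

/-- A drawing is planarly connected if for any two crossing edges, two of
their endpoints are joined by a crossing-free edge. -/
def IsPlanarlyConnected (Γ : Drawing G) : Prop :=
  ∀ e f : Sym2 V, Γ.Crosses e f →
    ∃ a b : V, a ∈ e ∧ b ∈ f ∧ G.Adj a b ∧ Γ.edgeCrossings s(a, b) = ∅

/-- A drawing is straight-line if every edge is drawn as the line segment
between the images of its endpoints. -/
def IsStraight (Γ : Drawing G) : Prop :=
  ∀ u v : V, G.Adj u v → ∀ t ∈ Set.Icc (0:ℝ) 1,
    Γ.arc u v t = (1 - t) • Γ.vpos u + t • Γ.vpos v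

/-- A straight-line RAC drawing: straight-line and any two crossing edges are
perpendicular. -/
def IsRAC (Γ : Drawing G) : Prop :=
  Γ.IsStraight ∧
    ∀ u v w z : V, G.Adj u v → G.Adj w z → Γ.Crosses s(u, v) s(w, z) →
      (Γ.vpos v - Γ.vpos u).1 * (Γ.vpos z - Γ.vpos w).1 +
        (Γ.vpos v - Γ.vpos u).2 * (Γ.vpos z - Γ.vpos w).2 = 0

end Drawing

/-- The crossing number of `G`: the minimum number of crossings over all
drawings of `G`. -/
def crNum {V : Type} (G : SimpleGraph V) : ℕ :=
  sInf {n | ∃ Γ : Drawing G, Γ.crossings = n}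

/-- The crossing number of `G` restricted to drawings satisfying `P`. -/
def crNumRestricted {V : Type} (G : SimpleGraph V) (P : Drawing G → Prop) : ℕ :=
  sInf {n | ∃ Γ : Drawing G, P Γ ∧ Γ.crossings = n}

/-- The rectilinear crossing number of `G`. -/
def rectCrNum {V : Type} (G : SimpleGraph V) : ℕ :=
  crNumRestricted G (fun Γ => Γ.IsStraight)

/-- An ℓ₂-bundle between `x` and `y`: `P` is the set of the internal vertices
of ℓ internally disjoint paths of length two from `x` to `y`, all of whose
internal vertices have degree exactly two in `G` (here ℓ = `P.card`). -/
def IsL2Bundle {V : Type} (G : SimpleGraph V) (x y : V) (P : Finset V) : Prop :=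
  x ≠ y ∧ x ∉ P ∧ y ∉ P ∧
    ∀ p ∈ P, G.Adj x p ∧ G.Adj p y ∧ (G.neighborSet p).ncard = 2

/-- Two drawings of `G` are weakly isomorphic: there is an incidence-preserving
one-to-one correspondence of vertices and edges that preserves crossings. -/
def WeaklyIso {V : Type} {G : SimpleGraph V} (Γ Γ' : Drawing G) : Prop :=
  ∃ φ : G ≃g G, ∀ e f : Sym2 V,
    Γ.Crosses e f ↔ Γ'.Crosses (Sym2.map (fun a => φ a) e) (Sym2.map (fun a => φ a) f)

theorem exists_continuous_log {A : Type} [TopologicalSpace A] [SimplyConnectedSpace A]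
    [LocallyPathConnectedSpace A] (f : A → ℂ) (hf : Continuous f) (h0 : ∀ a, f a ≠ 0) :
    ∃ L : A → ℂ, Continuous L ∧ ∀ a, Complex.exp (L a) = f a := by
  obtain ⟨a₀⟩ : Nonempty A := inferInstance
  obtain ⟨L, ⟨-, hL⟩, -⟩ := Complex.isCoveringMapOn_exp.existsUnique_continuousMap_lifts
    ⟨f, hf⟩ (Complex.exp_log (h0 a₀)) h0
  exact ⟨L, L.continuous, fun a => congrFun hL a⟩

theorem sub_eq_sub_of_exp_eq_const_mul {g h : ℝ → ℂ} (hg : Continuous g) (hh : Continuous h)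
    {c : ℂ} (hgh : ∀ t, Complex.exp (g t) = c * Complex.exp (h t)) :
    g 1 - g 0 = h 1 - h 0 := by
  have hc : c ≠ 0 := by
    rintro rfl
    exact Complex.exp_ne_zero (g 0) (by simpa using hgh 0)
  have key : ∃ n : ℝ → ℤ, ∀ t, g t - h t = Complex.log c + n t * (2 * Real.pi * Complex.I) := by
    have (t : ℝ) : ∃ n : ℤ, g t - h t = Complex.log c + n * (2 * Real.pi * Complex.I) := by
      rw [← Complex.exp_eq_exp_iff_exists_int, Complex.exp_sub, hgh, Complex.exp_log hc,
        mul_div_assoc, div_self (Complex.exp_ne_zero _), mul_one]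
    choose n hn using this
    exact ⟨n, hn⟩
  obtain ⟨n, hn⟩ := key
  have hpi : (2 * Real.pi * Complex.I : ℂ) ≠ 0 := Complex.two_pi_I_ne_zero
  have hcont : Continuous fun t => (n t : ℝ) := by
    have : (fun t => (n t : ℝ)) =
        fun t => ((g t - h t - Complex.log c) / (2 * Real.pi * Complex.I)).re := by
      funext t
      rw [hn t, add_sub_cancel_left, mul_div_assoc, div_self hpi]
      simp
    rw [this]
    fun_prop
  have hcont' : Continuous n := Int.isClosedEmbedding_coe_real.isInducing.continuous_iff.2 hcont
  have : n 1 = n 0 := PreconnectedSpace.constant inferInstance hcont'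
  have h1 := hn 1
  have h0 := hn 0
  rw [this] at h1
  linear_combination h1 - h0

theorem exists_logVariation (f : ℝ → ℂ) (hf : Continuous f) (h0 : ∀ t, f t ≠ 0) :
    ∃ α : ℂ, Complex.exp α = f 1 / f 0 ∧
      ∀ (c : ℂ) (g : ℝ → ℂ), Continuous g → (∀ t, Complex.exp (g t) = c * f t) →
        g 1 - g 0 = α := by
  obtain ⟨L, hL, hLf⟩ := exists_continuous_log f hf h0
  refine ⟨L 1 - L 0, by rw [Complex.exp_sub, hLf, hLf], fun c g hg hgf => ?_⟩
  exact sub_eq_sub_of_exp_eq_const_mul hg hL (c := c) fun t => by rw [hgf, hLf]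

/-- Any continuous drawing of `K₃,₃` has two independent edges that meet. -/
theorem exists_independent_curves_meet (a b : Fin 3 → ℂ) (γ : Fin 3 → Fin 3 → ℝ → ℂ)
    (hγ : ∀ i j, Continuous (γ i j)) (hγ0 : ∀ i j, γ i j 0 = a i) (hγ1 : ∀ i j, γ i j 1 = b j) :
    ∃ i i' j j', i ≠ i' ∧ j ≠ j' ∧ ∃ s t, γ i j s = γ i' j' t := by
  by_contra! hdisj
  have third : ∀ i : Fin 3, ∃ i', i' ≠ i := by decide
  have hαne : ∀ i j i', i ≠ i' → ∀ t, γ i j t - a i' ≠ 0 := by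
    intro i j i' hi t h
    obtain ⟨j', hj'⟩ := third j
    exact hdisj i i' j j' hi hj'.symm t 0 (by rw [hγ0]; exact sub_eq_zero.1 h)
  have hβne : ∀ i j j', j ≠ j' → ∀ t, γ i j t - b j' ≠ 0 := by
    intro i j j' hj t h
    obtain ⟨i', hi'⟩ := third i
    exact hdisj i i' j j' hi'.symm hj t 1 (by rw [hγ1]; exact sub_eq_zero.1 h)
  have hab : ∀ i j, b j - a i ≠ 0 := by
    intro i j
    obtain ⟨i', hi'⟩ := third i
    simpa [hγ1] using hαne i' j i hi' 1
  have haa : ∀ i i', i ≠ i' → a i - a i' ≠ 0 := by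
    intro i i' hi
    simpa [hγ0] using hαne i 0 i' hi 0
  have hbb : ∀ j j', j ≠ j' → b j - b j' ≠ 0 := by
    intro j j' hj
    simpa [hγ1] using hβne 0 j j' hj 1
  have hα : ∀ i j i', ∃ α : ℂ, i ≠ i' → Complex.exp α = (b j - a i') / (a i - a i') ∧
      ∀ (c : ℂ) (g : ℝ → ℂ), Continuous g → (∀ t, Complex.exp (g t) = c * (γ i j t - a i')) →
        g 1 - g 0 = α := by
    intro i j i'
    by_cases hi : i = i'
    · exact ⟨0, fun h => absurd hi h⟩
    obtain ⟨α, h1, h2⟩ := exists_logVariation (fun t => γ i j t - a i')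
      ((hγ i j).sub continuous_const) (hαne i j i' hi)
    exact ⟨α, fun _ => ⟨by simpa only [hγ0, hγ1] using h1, h2⟩⟩
  have hβ : ∀ i j j', ∃ β : ℂ, j ≠ j' → Complex.exp β = (b j - b j') / (a i - b j') ∧
      ∀ (c : ℂ) (g : ℝ → ℂ), Continuous g → (∀ t, Complex.exp (g t) = c * (γ i j t - b j')) →
        g 1 - g 0 = β := by
    intro i j j'
    by_cases hj : j = j'
    · exact ⟨0, fun h => absurd hj h⟩
    obtain ⟨β, h1, h2⟩ := exists_logVariation (fun t => γ i j t - b j')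
      ((hγ i j).sub continuous_const) (hβne i j j' hj)
    exact ⟨β, fun _ => ⟨by simpa only [hγ0, hγ1] using h1, h2⟩⟩
  choose α hα using hα
  choose β hβ using hβ
  have square : ∀ i i' j j', i ≠ i' → j ≠ j' →
      α i j i' + β i' j' j = α i' j' i + β i j j' := by
    intro i i' j j' hi hj
    obtain ⟨L, hL, hLf⟩ := exists_continuous_log (fun p : ℝ × ℝ => γ i j p.1 - γ i' j' p.2)
      (((hγ i j).comp continuous_fst).sub ((hγ i' j').comp continuous_snd))
      (fun p => sub_ne_zero.2 (hdisj i i' j j' hi hj p.1 p.2))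
    have e1 := (hα i j i' hi).2 1 (fun t => L (t, 0)) (by fun_prop)
      (fun t => by rw [hLf]; simp [hγ0])
    have e2 := (hβ i j j' hj).2 1 (fun t => L (t, 1)) (by fun_prop)
      (fun t => by rw [hLf]; simp [hγ1])
    have e3 := (hα i' j' i hi.symm).2 (-1) (fun t => L (0, t)) (by fun_prop)
      (fun t => by rw [hLf]; simp [hγ0])
    have e4 := (hβ i' j' j hj.symm).2 (-1) (fun t => L (1, t)) (by fun_prop)
      (fun t => by rw [hLf]; simp [hγ1])
    rw [← e1, ← e2, ← e3, ← e4]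
    ring
  have total : (∑ j, (α 0 j 1 - α 1 j 0 + α 0 j 2 - α 2 j 0 + α 1 j 2 - α 2 j 1)) +
      (β 2 0 1 - β 0 0 1 + (β 2 0 2 - β 0 0 2) + (β 2 1 0 - β 0 1 0) + (β 2 1 2 - β 0 1 2) +
        (β 2 2 0 - β 0 2 0) + (β 2 2 1 - β 0 2 1)) = 0 := by
    have h01 := fun j j' => square 0 1 j j' (by decide)
    have h02 := fun j j' => square 0 2 j j' (by decide)
    have h12 := fun j j' => square 1 2 j j' (by decide)
    simp only [Fin.sum_univ_three]
    linear_combination (1 / 2 : ℂ) * (h01 0 1 (by decide) + h01 0 2 (by decide) +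
      h01 1 0 (by decide) + h01 1 2 (by decide) + h01 2 0 (by decide) + h01 2 1 (by decide) +
      h02 0 1 (by decide) + h02 0 2 (by decide) +
      h02 1 0 (by decide) + h02 1 2 (by decide) + h02 2 0 (by decide) + h02 2 1 (by decide) +
      h12 0 1 (by decide) + h12 0 2 (by decide) +
      h12 1 0 (by decide) + h12 1 2 (by decide) + h12 2 0 (by decide) + h12 2 1 (by decide))
  have pairExp : ∀ i i' j, i ≠ i' → Complex.exp (α i j i' - α i' j i) =
      -((b j - a i') / (b j - a i)) := by
    intro i i' j hi
    rw [Complex.exp_sub, (hα i j i' hi).1, (hα i' j i hi.symm).1]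
    have h1 := hab i j
    have h2 := haa i i' hi
    have h3 := haa i' i hi.symm
    field_simp
    ring
  have lastExp : ∀ j j', j ≠ j' → Complex.exp (β 2 j j' - β 0 j j') =
      (b j' - a 0) / (b j' - a 2) := by
    intro j j' hj
    rw [Complex.exp_sub, (hβ 2 j j' hj).1, (hβ 0 j j' hj).1, ← neg_sub (b j') (a 0),
      ← neg_sub (b j') (a 2)]
    have h1 := hab 0 j'
    have h2 := hab 2 j'
    have h3 := hbb j j' hj
    field_simp
  have prodExp : ∀ j, Complex.exp (α 0 j 1 - α 1 j 0 + α 0 j 2 - α 2 j 0 + α 1 j 2 - α 2 j 1) =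
      -((b j - a 2) / (b j - a 0)) ^ 2 := by
    intro j
    rw [show α 0 j 1 - α 1 j 0 + α 0 j 2 - α 2 j 0 + α 1 j 2 - α 2 j 1 =
      (α 0 j 1 - α 1 j 0) + (α 0 j 2 - α 2 j 0) + (α 1 j 2 - α 2 j 1) by ring,
      Complex.exp_add, Complex.exp_add, pairExp 0 1 j (by decide), pairExp 0 2 j (by decide),
      pairExp 1 2 j (by decide)]
    have h0 := hab 0 j
    have h1 := hab 1 j
    have h2 := hab 2 j
    field_simp
  have h := congrArg Complex.exp total
  rw [Complex.exp_zero, Complex.exp_add, Complex.exp_sum, Fin.prod_univ_three, prodExp, prodExp,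
    prodExp, Complex.exp_add, Complex.exp_add, Complex.exp_add, Complex.exp_add, Complex.exp_add,
    lastExp 0 1 (by decide), lastExp 0 2 (by decide), lastExp 1 0 (by decide),
    lastExp 1 2 (by decide), lastExp 2 0 (by decide), lastExp 2 1 (by decide)] at h
  have h0 := hab 0
  have h2 := hab 2
  have := h0 0
  have := h0 1
  have := h0 2
  have := h2 0
  have := h2 1
  have := h2 2
  have contra : (1 : ℂ) = -1 := h.symm.trans (by field_simp)
  norm_num at contra

/-- The arc from `a` to `b` of the parabola `y = σ (x - a) (b - x)`. -/
def parabolaArc (σ a b t : ℝ) : ℝ × ℝ :=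
  ((1 - t) * a + t * b, σ * (t * (1 - t) * (b - a) ^ 2))

theorem parabolaArc_snd (σ a b t : ℝ) : (parabolaArc σ a b t).2 =
    σ * (((parabolaArc σ a b t).1 - a) * (b - (parabolaArc σ a b t).1)) := by
  simp only [parabolaArc]
  ring

theorem parabolaArc_symm (σ a b t : ℝ) : parabolaArc σ a b t = parabolaArc σ b a (1 - t) := by
  simp only [parabolaArc, Prod.mk.injEq]
  constructor <;> ring

theorem parabolaArc_injective (σ : ℝ) {a b : ℝ} (h : a ≠ b) :
    Function.Injective (parabolaArc σ a b) := by
  intro t t' htt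
  have h1 : (1 - t) * a + t * b = (1 - t') * a + t' * b := congrArg Prod.fst htt
  have h2 : (t - t') * (b - a) = 0 := by linear_combination h1
  rcases mul_eq_zero.1 h2 with h3 | h3
  · linarith
  · exact absurd (by linarith) h

theorem parabolaArc_snd_ne_zero {σ a b t : ℝ} (hσ : σ ≠ 0) (h : a ≠ b) (ht : t ∈ Ioo (0 : ℝ) 1) :
    (parabolaArc σ a b t).2 ≠ 0 := by
  have h1 : t ≠ 0 := ht.1.ne'
  have h2 : 1 - t ≠ 0 := sub_ne_zero.2 ht.2.ne'
  have h3 : b - a ≠ 0 := sub_ne_zero.2 h.symm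
  simp only [parabolaArc]
  positivity

/-- Two parabolic arcs on the same side of the axis, with different endpoint pairs, meet at most
once. -/
theorem subsingleton_inter_parabolaArc {σ a b c d : ℝ}
    (hne : ¬ (a = c ∧ b = d ∨ a = d ∧ b = c)) :
    (range (parabolaArc σ a b) ∩ range (parabolaArc σ c d)).Subsingleton ∨ σ = 0 := by
  by_cases hσ : σ = 0
  · exact Or.inr hσ
  refine Or.inl ?_
  rintro p ⟨⟨t, ht⟩, ⟨s, hs⟩⟩ q ⟨⟨t', ht'⟩, ⟨s', hs'⟩⟩
  have hp1 := parabolaArc_snd σ a b t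
  have hp2 := parabolaArc_snd σ c d s
  have hq1 := parabolaArc_snd σ a b t'
  have hq2 := parabolaArc_snd σ c d s'
  rw [ht] at hp1
  rw [hs] at hp2
  rw [ht'] at hq1
  rw [hs'] at hq2
  have hp : (p.1 - a) * (b - p.1) = (p.1 - c) * (d - p.1) :=
    mul_left_cancel₀ hσ (hp1.symm.trans hp2)
  have hq : (q.1 - a) * (b - q.1) = (q.1 - c) * (d - q.1) :=
    mul_left_cancel₀ hσ (hq1.symm.trans hq2)
  have hmul : (p.1 - q.1) * (a + b - c - d) = 0 := by linear_combination hp - hq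
  rcases mul_eq_zero.1 hmul with h | h
  · have h1 : p.1 = q.1 := by linarith
    exact Prod.ext h1 (by rw [hp1, hq1, h1])
  · refine absurd ?_ hne
    have hd : d = a + b - c := by linarith
    subst hd
    have : (a - c) * (b - c) = 0 := by linear_combination -hp
    rcases mul_eq_zero.1 this with h' | h'
    · exact Or.inl ⟨by linarith, by linarith⟩
    · exact Or.inr ⟨by linarith, by linarith⟩

/-- Two parabolic arcs on the same side of the axis that meet off the axis have interleaving
endpoints. -/
theorem interleave_of_parabolaArc_eq {σ σ' a b c d t s : ℝ} (hσ : σ = 1 ∨ σ = -1)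
    (hσ' : σ' = 1 ∨ σ' = -1) (hab : a < b) (hcd : c < d) (hne : ¬ (a = c ∧ b = d))
    (ht : t ∈ Ioo (0 : ℝ) 1) (hs : s ∈ Ioo (0 : ℝ) 1)
    (h : parabolaArc σ a b t = parabolaArc σ' c d s) :
    σ = σ' ∧ (a < c ∧ c < b ∧ b < d ∨ c < a ∧ a < d ∧ d < b) := by
  have h1 := parabolaArc_snd σ a b t
  have h2 := parabolaArc_snd σ' c d s
  have hx1 : (parabolaArc σ a b t).1 = (1 - t) * a + t * b := rfl
  have hx2 : (parabolaArc σ' c d s).1 = (1 - s) * c + s * d := rfl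
  rw [← h] at h2 hx2
  generalize parabolaArc σ a b t = p at *
  obtain ⟨x, y⟩ := p
  simp only at *
  have ha : 0 < x - a := by nlinarith [mul_pos ht.1 (sub_pos.2 hab)]
  have hb : 0 < b - x := by nlinarith [mul_pos (sub_pos.2 ht.2) (sub_pos.2 hab)]
  have hc : 0 < x - c := by nlinarith [mul_pos hs.1 (sub_pos.2 hcd)]
  have hd : 0 < d - x := by nlinarith [mul_pos (sub_pos.2 hs.2) (sub_pos.2 hcd)]
  have hp := mul_pos ha hb
  have hq := mul_pos hc hd
  have hσσ : σ = σ' := by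
    rcases hσ with rfl | rfl <;> rcases hσ' with rfl | rfl <;> first | rfl | (exfalso; linarith)
  subst hσσ
  have hσ0 : σ ≠ 0 := by rcases hσ with rfl | rfl <;> norm_num
  have key : (x - a) * (b - x) = (x - c) * (d - x) :=
    mul_left_cancel₀ hσ0 (h1.symm.trans h2)
  refine ⟨rfl, ?_⟩
  rcases lt_trichotomy a c with hac | hac | hac
  · refine Or.inl ⟨hac, by linarith, ?_⟩
    by_contra! hbd
    nlinarith
  · subst hac
    exact absurd ⟨rfl, by linarith [mul_left_cancel₀ ha.ne' key]⟩ hne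
  · refine Or.inr ⟨hac, by linarith, ?_⟩
    by_contra! hbd
    nlinarith

section BookDrawing

variable {V : Type} {G : SimpleGraph V}

/-- The data of a two-page book drawing whose pairs of crossing edges are bicoloured. -/
structure BookLayout (G : SimpleGraph V) where
  pos : V → ℝ
  pos_injective : Function.Injective pos
  page : Sym2 V → ℝ
  page_eq : ∀ e, page e = 1 ∨ page e = -1
  color : Sym2 V → Prop
  color_ne : ∀ u v w z, G.Adj u v → G.Adj w z → page s(u, v) = page s(w, z) →
    pos u < pos w → pos w < pos v → pos v < pos z → ¬ (color s(u, v) ↔ color s(w, z))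

namespace BookLayout

variable (B : BookLayout G)

theorem page_ne_zero (e : Sym2 V) : B.page e ≠ 0 := by
  rcases B.page_eq e with h | h <;> rw [h] <;> norm_num

def arc (u v : V) (t : ℝ) : ℝ × ℝ := parabolaArc (B.page s(u, v)) (B.pos u) (B.pos v) t

theorem arc_symm (u v : V) (t : ℝ) : B.arc u v t = B.arc v u (1 - t) := by
  simp only [arc, Sym2.eq_swap (a := u) (b := v)]
  exact parabolaArc_symm _ _ _ _

theorem arc_zero (u v : V) : B.arc u v 0 = (B.pos u, 0) := by simp [arc, parabolaArc]

theorem arc_one (u v : V) : B.arc u v 1 = (B.pos v, 0) := by simp [arc, parabolaArc]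

theorem pos_ne {u v : V} (h : G.Adj u v) : B.pos u ≠ B.pos v := B.pos_injective.ne h.ne

theorem arc_image_subset_range (u v : V) :
    B.arc u v '' Icc 0 1 ⊆ range (parabolaArc (B.page s(u, v)) (B.pos u) (B.pos v)) := by
  rintro _ ⟨t, -, rfl⟩
  exact ⟨t, rfl⟩

theorem subsingleton_inter {u v w z : V} (hne : s(u, v) ≠ s(w, z))
    (hp : B.page s(u, v) = B.page s(w, z)) :
    ((B.arc u v '' Icc 0 1) ∩ (B.arc w z '' Icc 0 1)).Subsingleton := by
  refine Set.Subsingleton.anti ?_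
    (inter_subset_inter (B.arc_image_subset_range u v) (B.arc_image_subset_range w z))
  rw [← hp]
  refine (subsingleton_inter_parabolaArc ?_).resolve_right (B.page_ne_zero _)
  simpa [B.pos_injective.eq_iff] using hne

/-- Reduction of a meeting point off the axis to one with both arcs directed rightwards. -/
theorem exists_rightward {u v : V} (h : G.Adj u v) {p : ℝ × ℝ} (hp : p ∈ B.arc u v '' Icc 0 1)
    (hpV : p ∉ range fun u => (B.pos u, (0 : ℝ))) :
    ∃ u' v', s(u', v') = s(u, v) ∧ B.pos u' < B.pos v' ∧ ∃ t ∈ Ioo (0 : ℝ) 1,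
      B.arc u' v' t = p := by
  obtain ⟨t, ht, rfl⟩ := hp
  have ht' : t ∈ Ioo (0 : ℝ) 1 := by
    refine ⟨lt_of_le_of_ne ht.1 ?_, lt_of_le_of_ne ht.2 ?_⟩
    · rintro rfl
      exact hpV ⟨u, (B.arc_zero u v).symm⟩
    · rintro rfl
      exact hpV ⟨v, (B.arc_one u v).symm⟩
  rcases (B.pos_ne h).lt_or_gt with hlt | hlt
  · exact ⟨u, v, rfl, hlt, t, ht', rfl⟩
  · exact ⟨v, u, Sym2.eq_swap, hlt, 1 - t, ⟨by linarith [ht'.2], by linarith [ht'.1]⟩,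
      (B.arc_symm u v t).symm⟩

/-- Edges meeting off the vertices interleave and lie on a common page. -/
theorem exists_interleave {u v w z : V} (h : G.Adj u v) (h' : G.Adj w z)
    (hne : s(u, v) ≠ s(w, z)) {p : ℝ × ℝ} (hp : p ∈ B.arc u v '' Icc 0 1)
    (hp' : p ∈ B.arc w z '' Icc 0 1) (hpV : p ∉ range fun u => (B.pos u, (0 : ℝ))) :
    B.page s(u, v) = B.page s(w, z) ∧ ∃ u' v' w' z',
      (s(u', v') = s(u, v) ∧ s(w', z') = s(w, z) ∨ s(u', v') = s(w, z) ∧ s(w', z') = s(u, v)) ∧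
      B.pos u' < B.pos w' ∧ B.pos w' < B.pos v' ∧ B.pos v' < B.pos z' := by
  obtain ⟨u', v', huv, hlt, t, ht, rfl⟩ := B.exists_rightward h hp hpV
  obtain ⟨w', z', hwz, hlt', s, hs, hst⟩ := B.exists_rightward h' hp' hpV
  have hne' : ¬ (B.pos u' = B.pos w' ∧ B.pos v' = B.pos z') := by
    rintro ⟨h1, h2⟩
    rw [← huv, ← hwz, B.pos_injective h1, B.pos_injective h2] at hne
    exact hne rfl
  obtain ⟨h1, h2⟩ := interleave_of_parabolaArc_eq (B.page_eq _) (B.page_eq _) hlt hlt' hne' ht hs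
    hst.symm
  rw [huv, hwz] at h1
  refine ⟨h1, ?_⟩
  rcases h2 with h2 | h2
  · exact ⟨u', v', w', z', Or.inl ⟨huv, hwz⟩, h2⟩
  · exact ⟨w', z', u', v', Or.inr ⟨hwz, huv⟩, h2⟩

theorem color_ne_of_mem {u v w z : V} (h : G.Adj u v) (h' : G.Adj w z)
    (hne : s(u, v) ≠ s(w, z)) {p : ℝ × ℝ} (hp : p ∈ B.arc u v '' Icc 0 1)
    (hp' : p ∈ B.arc w z '' Icc 0 1) (hpV : p ∉ range fun u => (B.pos u, (0 : ℝ))) :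
    ¬ (B.color s(u, v) ↔ B.color s(w, z)) := by
  obtain ⟨hpage, u', v', w', z', hs, h1, h2, h3⟩ := B.exists_interleave h h' hne hp hp' hpV
  have adj {a b c d : V} (e : s(a, b) = s(c, d)) (hcd : G.Adj c d) : G.Adj a b := by
    rwa [← G.mem_edgeSet, e]
  rcases hs with ⟨e1, e2⟩ | ⟨e1, e2⟩
  · have := B.color_ne u' v' w' z' (adj e1 h) (adj e2 h') (by rw [e1, e2, hpage]) h1 h2 h3
    rwa [e1, e2] at this
  · have := B.color_ne u' v' w' z' (adj e1 h') (adj e2 h) (by rw [e1, e2, hpage]) h1 h2 h3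
    rwa [e1, e2, iff_comm] at this

/-- The drawing with vertices on the `x`-axis and edges drawn as parabolic arcs on either side. -/
def drawing : Drawing G where
  vpos u := (B.pos u, 0)
  vpos_inj u v h := B.pos_injective (congrArg Prod.fst h)
  arc := B.arc
  arc_symm := B.arc_symm
  arc_cont u v _ := by
    unfold arc parabolaArc
    fun_prop
  arc_injOn u v h := (parabolaArc_injective _ (B.pos_ne h)).injOn
  arc_start u v _ := B.arc_zero u v
  arc_end u v _ := B.arc_one u v
  arc_avoids u v h t ht := by
    rintro ⟨w, hw⟩
    exact parabolaArc_snd_ne_zero (B.page_ne_zero _) (B.pos_ne h) ht (congrArg Prod.snd hw).symm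
  inter_finite u v w z h h' hne := by
    by_cases hp : B.page s(u, v) = B.page s(w, z)
    · exact (B.subsingleton_inter hne hp).finite
    · refine Set.Finite.subset (s := {(B.pos u, (0 : ℝ)), (B.pos v, 0)}) (by simp) ?_
      rintro p ⟨hp1, hp2⟩
      have hV : p ∈ range fun u => (B.pos u, (0 : ℝ)) := by
        by_contra hV
        exact hp (B.exists_interleave h h' hne hp1 hp2 hV).1
      obtain ⟨t, ht, rfl⟩ := hp1
      rcases eq_or_lt_of_le ht.1 with rfl | h0
      · simp [B.arc_zero]
      rcases eq_or_lt_of_le ht.2 with rfl | h1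
      · simp [B.arc_one]
      obtain ⟨x, hx⟩ := hV
      exact absurd (congrArg Prod.snd hx).symm
        (parabolaArc_snd_ne_zero (B.page_ne_zero _) (B.pos_ne h) ⟨h0, h1⟩)
  no_triple_point p hp u₁ v₁ u₂ v₂ u₃ v₃ h₁ h₂ h₃ n₁₂ n₁₃ n₂₃ := by
    rintro ⟨p₁, p₂, p₃⟩
    have c₁₂ := B.color_ne_of_mem h₁ h₂ n₁₂ p₁ p₂ hp
    have c₁₃ := B.color_ne_of_mem h₁ h₃ n₁₃ p₁ p₃ hp
    have c₂₃ := B.color_ne_of_mem h₂ h₃ n₂₃ p₂ p₃ hp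
    tauto

theorem crossing_interleave {e f : Sym2 V} {p : ℝ × ℝ} (h : B.drawing.Crossing e f p) :
    B.page e = B.page f ∧ ∃ u v w z,
      (s(u, v) = e ∧ s(w, z) = f ∨ s(u, v) = f ∧ s(w, z) = e) ∧
      B.pos u < B.pos w ∧ B.pos w < B.pos v ∧ B.pos v < B.pos z := by
  induction e with | h a b =>
  induction f with | h c d =>
  obtain ⟨h1, h2, hne, hp, hp', hpV⟩ := h
  exact B.exists_interleave h1 h2 hne hp hp' hpV

theorem subsingleton_crossing (e f : Sym2 V) : {p | B.drawing.Crossing e f p}.Subsingleton := by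
  intro p h q h'
  have hpage := (B.crossing_interleave h).1
  induction e with | h a b =>
  induction f with | h c d =>
  exact B.subsingleton_inter h.2.2.1 hpage ⟨h.2.2.2.1, h.2.2.2.2.1⟩ ⟨h'.2.2.2.1, h'.2.2.2.2.1⟩

end BookLayout

end BookDrawing

section FanGraph

/-- The non-hub pairs of a `K₃,₃` joined by bundles of paths of length two. -/
inductive Spoke
  | d₁c₂ | d₁c₄ | d₂c₁ | d₂c₃ | d₁d₂

/-- Vertices of the graph: a `K₃,₃` with parts `c₁, c₃, d₁` and `c₂, c₄, d₂` whose edges other than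
`c₁c₂` are replaced by bundles of paths. -/
inductive Vtx (k ℓ : ℕ)
  | c₁ | c₂ | c₃ | c₄ | d₁ | d₂
  | b (i : Fin k)
  | m (i : Fin k) (j : Fin ℓ)
  | spoke (x : Spoke) (j : Fin ℓ)
  | p (j : Fin ℓ) | q (j : Fin ℓ) | r (j : Fin ℓ) | s (j : Fin ℓ)
  | isolated (t : Fin (8 * k * ℓ + 18 * ℓ + 2 * k + 4))

/-- Edges of the graph, named after their endpoints. -/
inductive Edge (k ℓ : ℕ)
  | c₁c₂
  | c₃b (i : Fin k)
  | bm (i : Fin k) (j : Fin ℓ)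
  | mc₄ (i : Fin k) (j : Fin ℓ)
  | spokeFst (x : Spoke) (j : Fin ℓ)
  | spokeSnd (x : Spoke) (j : Fin ℓ)
  | c₂p (j : Fin ℓ) | pq (j : Fin ℓ) | qc₃ (j : Fin ℓ)
  | c₄r (j : Fin ℓ) | rs (j : Fin ℓ) | sc₁ (j : Fin ℓ)

variable {k ℓ : ℕ}

namespace Spoke

def fst : Spoke → Vtx k ℓ
  | d₁c₂ => .d₁ | d₁c₄ => .d₁ | d₂c₁ => .d₂ | d₂c₃ => .d₂ | d₁d₂ => .d₁

def snd : Spoke → Vtx k ℓ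
  | d₁c₂ => .c₂ | d₁c₄ => .c₄ | d₂c₁ => .c₁ | d₂c₃ => .c₃ | d₁d₂ => .d₂

end Spoke

namespace Edge

def src : Edge k ℓ → Vtx k ℓ
  | c₁c₂ => .c₁
  | c₃b _ => .c₃
  | bm i _ => .b i
  | mc₄ i j => .m i j
  | spokeFst x _ => x.fst
  | spokeSnd x j => .spoke x j
  | c₂p _ => .c₂ | pq j => .p j | qc₃ j => .q j
  | c₄r _ => .c₄ | rs j => .r j | sc₁ j => .s j

def tgt : Edge k ℓ → Vtx k ℓ
  | c₁c₂ => .c₂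
  | c₃b i => .b i
  | bm i j => .m i j
  | mc₄ _ _ => .c₄
  | spokeFst x j => .spoke x j
  | spokeSnd x _ => x.snd
  | c₂p j => .p j | pq j => .q j | qc₃ _ => .c₃
  | c₄r j => .r j | rs j => .s j | sc₁ _ => .c₁

theorem src_ne_tgt (ε : Edge k ℓ) : ε.src ≠ ε.tgt := by
  rcases ε with _ | _ | _ | _ | ⟨_ | _, _⟩ | ⟨_ | _, _⟩ | _ | _ | _ | _ | _ | _ <;>
    simp [src, tgt, Spoke.fst, Spoke.snd]

def ends (ε : Edge k ℓ) : Sym2 (Vtx k ℓ) := s(ε.src, ε.tgt)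

theorem ends_injective : Function.Injective (ends : Edge k ℓ → _) := by
  intro ε ε' h
  rcases ε with _ | _ | _ | _ | ⟨_ | _, _⟩ | ⟨_ | _, _⟩ | _ | _ | _ | _ | _ | _ <;>
  rcases ε' with _ | _ | _ | _ | ⟨_ | _, _⟩ | ⟨_ | _, _⟩ | _ | _ | _ | _ | _ | _ <;>
    simp [ends, src, tgt, Spoke.fst, Spoke.snd] at h ⊢ <;> simp [h]

end Edge

def vtxEquiv (k ℓ : ℕ) : Vtx k ℓ ≃ (Fin 6 ⊕ Fin k) ⊕ (Fin k × Fin ℓ) ⊕ (Fin 9 × Fin ℓ) ⊕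
    Fin (8 * k * ℓ + 18 * ℓ + 2 * k + 4) where
  toFun
    | .c₁ => .inl (.inl 0) | .c₂ => .inl (.inl 1) | .c₃ => .inl (.inl 2)
    | .c₄ => .inl (.inl 3) | .d₁ => .inl (.inl 4) | .d₂ => .inl (.inl 5)
    | .b i => .inl (.inr i)
    | .m i j => .inr (.inl (i, j))
    | .spoke .d₁c₂ j => .inr (.inr (.inl (0, j)))
    | .spoke .d₁c₄ j => .inr (.inr (.inl (1, j)))
    | .spoke .d₂c₁ j => .inr (.inr (.inl (2, j)))
    | .spoke .d₂c₃ j => .inr (.inr (.inl (3, j)))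
    | .spoke .d₁d₂ j => .inr (.inr (.inl (4, j)))
    | .p j => .inr (.inr (.inl (5, j)))
    | .q j => .inr (.inr (.inl (6, j)))
    | .r j => .inr (.inr (.inl (7, j)))
    | .s j => .inr (.inr (.inl (8, j)))
    | .isolated t => .inr (.inr (.inr t))
  invFun
    | .inl (.inl 0) => .c₁ | .inl (.inl 1) => .c₂ | .inl (.inl 2) => .c₃
    | .inl (.inl 3) => .c₄ | .inl (.inl 4) => .d₁ | .inl (.inl 5) => .d₂
    | .inl (.inr i) => .b i
    | .inr (.inl (i, j)) => .m i j
    | .inr (.inr (.inl (0, j))) => .spoke .d₁c₂ j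
    | .inr (.inr (.inl (1, j))) => .spoke .d₁c₄ j
    | .inr (.inr (.inl (2, j))) => .spoke .d₂c₁ j
    | .inr (.inr (.inl (3, j))) => .spoke .d₂c₃ j
    | .inr (.inr (.inl (4, j))) => .spoke .d₁d₂ j
    | .inr (.inr (.inl (5, j))) => .p j
    | .inr (.inr (.inl (6, j))) => .q j
    | .inr (.inr (.inl (7, j))) => .r j
    | .inr (.inr (.inl (8, j))) => .s j
    | .inr (.inr (.inr t)) => .isolated t
  left_inv := by rintro (_ | _ | _ | _ | _ | _ | _ | _ | ⟨_ | _, _⟩ | _ | _ | _ | _ | _) <;> rfl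
  right_inv := by
    rintro ((t | _) | _ | ⟨t, _⟩ | _)
    · fin_cases t <;> rfl
    · rfl
    · rfl
    · fin_cases t <;> rfl
    · rfl

theorem nonempty_fin_equiv_vtx (k ℓ : ℕ) :
    Nonempty (Fin (9 * k * ℓ + 27 * ℓ + 3 * k + 10) ≃ Vtx k ℓ) := by
  refine ⟨(Fintype.equivOfCardEq ?_).trans (vtxEquiv k ℓ).symm⟩
  simp only [Fintype.card_fin, Fintype.card_sum, Fintype.card_prod]
  ring

variable {V : Type}

/-- The graph on `V` with the edges `Edge k ℓ`, after relabelling the vertices along `φ`. -/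
def fanGraph (φ : V ≃ Vtx k ℓ) : SimpleGraph V where
  Adj u v := ∃ ε : Edge k ℓ, ε.ends = s(φ u, φ v)
  symm := ⟨fun u v ⟨ε, h⟩ => ⟨ε, h.trans Sym2.eq_swap⟩⟩
  loopless := ⟨fun u ⟨ε, h⟩ => ε.src_ne_tgt (by
    rcases Sym2.eq_iff.1 h with h | h <;> rw [h.1, h.2])⟩

variable (φ : V ≃ Vtx k ℓ)

def Edge.sym2 (ε : Edge k ℓ) : Sym2 V := s(φ.symm ε.src, φ.symm ε.tgt)

theorem fanGraph_adj_symm (ε : Edge k ℓ) :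
    (fanGraph φ).Adj (φ.symm ε.src) (φ.symm ε.tgt) :=
  ⟨ε, by simp [Edge.ends]⟩

theorem Edge.sym2_eq_map (ε : Edge k ℓ) : ε.sym2 φ = Sym2.map φ.symm ε.ends := rfl

theorem Edge.sym2_injective : Function.Injective (Edge.sym2 φ) :=
  (Sym2.map.injective φ.symm.injective).comp Edge.ends_injective

theorem Edge.sym2_mem_edgeSet (ε : Edge k ℓ) : ε.sym2 φ ∈ (fanGraph φ).edgeSet :=
  fanGraph_adj_symm φ ε

theorem exists_sym2_eq {e : Sym2 V} (he : e ∈ (fanGraph φ).edgeSet) :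
    ∃ ε : Edge k ℓ, ε.sym2 φ = e := by
  induction e with | h u v =>
  obtain ⟨ε, hε⟩ := he
  exact ⟨ε, by rw [Edge.sym2_eq_map, hε]; simp⟩

/-- Lexicographic comparison of triples. -/
def TripleLt (x y : ℕ × ℕ × ℕ) : Prop :=
  x.1 < y.1 ∨ x.1 = y.1 ∧ (x.2.1 < y.2.1 ∨ x.2.1 = y.2.1 ∧ x.2.2 < y.2.2)

theorem TripleLt.asymm {x y : ℕ × ℕ × ℕ} (h : TripleLt x y) : ¬ TripleLt y x := by
  unfold TripleLt at *
  omega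

theorem TripleLt.trans {x y z : ℕ × ℕ × ℕ} (h : TripleLt x y) (h' : TripleLt y z) :
    TripleLt x z := by
  unfold TripleLt at *
  omega

theorem exists_strictMono_triple :
    ∃ F : ℕ × ℕ × ℕ → ℝ, Function.Injective F ∧ ∀ x y, F x < F y ↔ TripleLt x y := by
  have : Countable (ℕ ×ₗ ℕ ×ₗ ℕ) := inferInstanceAs (Countable (ℕ × ℕ × ℕ))
  obtain ⟨F⟩ := Order.embedding_from_countable_to_dense (α := ℕ ×ₗ ℕ ×ₗ ℕ) (β := ℝ)
  refine ⟨fun x => F (toLex (x.1, toLex x.2)), fun x y h => ?_, fun x y => ?_⟩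
  · have := congrArg ofLex (F.injective h)
    simp only [ofLex_toLex, Prod.mk.injEq, EmbeddingLike.apply_eq_iff_eq] at this
    exact Prod.ext this.1 this.2
  · rw [F.lt_iff_lt, Prod.Lex.toLex_lt_toLex, Prod.Lex.toLex_lt_toLex]
    rfl

/-- A two-page book layout given by a vertex order and a page for each edge, such that
interleaving edges on a common page consist of a `left` edge and a `right` edge, in this order. -/
structure FanLayout (k ℓ : ℕ) where
  key : Vtx k ℓ → ℕ × ℕ × ℕ
  key_injective : Function.Injective key
  lo : Edge k ℓ → Vtx k ℓ
  hi : Edge k ℓ → Vtx k ℓ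
  ends_eq : ∀ ε, ε.ends = s(lo ε, hi ε)
  lo_lt_hi : ∀ ε, TripleLt (key (lo ε)) (key (hi ε))
  upper : Edge k ℓ → Bool
  left : Edge k ℓ → Prop
  right : Edge k ℓ → Prop
  not_left_of_right : ∀ ε, right ε → ¬ left ε
  interleave : ∀ ε ε', upper ε = upper ε' → TripleLt (key (lo ε)) (key (lo ε')) →
    TripleLt (key (lo ε')) (key (hi ε)) → TripleLt (key (hi ε)) (key (hi ε')) →
    left ε ∧ right ε'

namespace FanLayout

variable (L : FanLayout k ℓ)

theorem eq_lo_hi {u v : V} {ε : Edge k ℓ} (h : ε.ends = s(φ u, φ v))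
    (hlt : TripleLt (L.key (φ u)) (L.key (φ v))) : φ u = L.lo ε ∧ φ v = L.hi ε := by
  rw [L.ends_eq] at h
  rcases Sym2.eq_iff.1 h with h | h
  · exact ⟨h.1.symm, h.2.symm⟩
  · have := L.lo_lt_hi ε
    rw [h.1, h.2] at this
    exact absurd hlt this.asymm

theorem left_right_of_interleave {u v w z : V} {ε ε' : Edge k ℓ} (h : ε.ends = s(φ u, φ v))
    (h' : ε'.ends = s(φ w, φ z)) (hp : L.upper ε = L.upper ε')
    (h1 : TripleLt (L.key (φ u)) (L.key (φ w))) (h2 : TripleLt (L.key (φ w)) (L.key (φ v)))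
    (h3 : TripleLt (L.key (φ v)) (L.key (φ z))) : L.left ε ∧ L.right ε' := by
  obtain ⟨e1, e2⟩ := L.eq_lo_hi φ h (h1.trans h2)
  obtain ⟨e3, e4⟩ := L.eq_lo_hi φ h' (h2.trans h3)
  rw [e1, e3] at h1
  rw [e2, e3] at h2
  rw [e2, e4] at h3
  exact L.interleave ε ε' hp h1 h2 h3

open Classical in
/-- The side of the axis on which an edge is drawn. -/
def page (e : Sym2 V) : ℝ := if ∃ ε : Edge k ℓ, L.upper ε = true ∧ ε.sym2 φ = e then 1 else -1

theorem page_sym2 (ε : Edge k ℓ) : L.page φ (ε.sym2 φ) = if L.upper ε then 1 else -1 := by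
  simp [page, (Edge.sym2_injective φ).eq_iff]

theorem upper_eq_of_page_eq {ε ε' : Edge k ℓ} (h : L.page φ (ε.sym2 φ) = L.page φ (ε'.sym2 φ)) :
    L.upper ε = L.upper ε' := by
  rw [page_sym2, page_sym2] at h
  rcases h1 : L.upper ε <;> rcases h2 : L.upper ε' <;> rw [h1, h2] at h <;> norm_num at h

theorem sym2_eq {u v : V} {ε : Edge k ℓ} (h : ε.ends = s(φ u, φ v)) : ε.sym2 φ = s(u, v) := by
  rw [Edge.sym2_eq_map, h]
  simp

def bookLayout : BookLayout (fanGraph φ) where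
  pos u := exists_strictMono_triple.choose (L.key (φ u))
  pos_injective :=
    exists_strictMono_triple.choose_spec.1.comp (L.key_injective.comp φ.injective)
  page := L.page φ
  page_eq e := by
    unfold page
    split_ifs <;> simp
  color e := ∃ ε, L.left ε ∧ ε.sym2 φ = e
  color_ne u v w z := by
    rintro ⟨ε, h⟩ ⟨ε', h'⟩ hp h1 h2 h3
    rw [exists_strictMono_triple.choose_spec.2] at h1 h2 h3
    rw [← sym2_eq φ h, ← sym2_eq φ h'] at hp ⊢
    have := L.left_right_of_interleave φ h h' (L.upper_eq_of_page_eq φ hp) h1 h2 h3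
    simp only [(Edge.sym2_injective φ).eq_iff, exists_eq_right]
    have := L.not_left_of_right ε' this.2
    tauto

def drawing : Drawing (fanGraph φ) := (L.bookLayout φ).drawing

theorem left_right_of_crossing {e f : Sym2 V} {p : ℝ × ℝ} (h : (L.drawing φ).Crossing e f p) :
    ∃ ε ε', L.left ε ∧ L.right ε' ∧
      (ε.sym2 φ = e ∧ ε'.sym2 φ = f ∨ ε.sym2 φ = f ∧ ε'.sym2 φ = e) := by
  obtain ⟨hp, u, v, w, z, hs, h1, h2, h3⟩ := (L.bookLayout φ).crossing_interleave h
  obtain ⟨he, hf, -⟩ := h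
  simp only [bookLayout, exists_strictMono_triple.choose_spec.2] at h1 h2 h3
  obtain ⟨ε, rfl⟩ := exists_sym2_eq φ he
  obtain ⟨ε', rfl⟩ := exists_sym2_eq φ hf
  have hup := L.upper_eq_of_page_eq φ hp
  have ends_eq {ε : Edge k ℓ} {u v : V} (h : s(u, v) = ε.sym2 φ) : ε.ends = s(φ u, φ v) := by
    rw [← Sym2.map_mk, h, Edge.sym2_eq_map, Sym2.map_map]
    simp
  rcases hs with ⟨e1, e2⟩ | ⟨e1, e2⟩
  · have := L.left_right_of_interleave φ (ends_eq e1) (ends_eq e2) hup h1 h2 h3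
    exact ⟨ε, ε', this.1, this.2, Or.inl ⟨rfl, rfl⟩⟩
  · have := L.left_right_of_interleave φ (ends_eq e1) (ends_eq e2) hup.symm h1 h2 h3
    exact ⟨ε', ε, this.1, this.2, Or.inr ⟨rfl, rfl⟩⟩

end FanLayout

/-- In this order the only crossings are those between the two bundles of paths of length three. -/
def bundleLayout (k ℓ : ℕ) : FanLayout k ℓ where
  key
    | .c₂ => (0, 0, 0) | .p j => (1, j, 0) | .spoke .d₁c₂ j => (2, j, 0) | .d₁ => (3, 0, 0)
    | .spoke .d₁d₂ j => (4, j, 0) | .spoke .d₁c₄ j => (5, j, 0) | .c₄ => (6, 0, 0)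
    | .r j => (7, j, 0) | .m i j => (8, i, j) | .b i => (9, k - i, 0) | .q j => (10, ℓ - j, 0)
    | .c₃ => (11, 0, 0) | .spoke .d₂c₃ j => (12, j, 0) | .d₂ => (13, 0, 0)
    | .spoke .d₂c₁ j => (14, j, 0) | .s j => (15, ℓ - j, 0) | .c₁ => (16, 0, 0)
    | .isolated t => (17, t, 0)
  key_injective u v h := by
    rcases u with _ | _ | _ | _ | _ | _ | ⟨⟨_, _⟩⟩ | ⟨⟨_, _⟩, ⟨_, _⟩⟩ |
      ⟨_ | _, ⟨_, _⟩⟩ | ⟨⟨_, _⟩⟩ | ⟨⟨_, _⟩⟩ | ⟨⟨_, _⟩⟩ | ⟨⟨_, _⟩⟩ | ⟨⟨_, _⟩⟩ <;>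
    rcases v with _ | _ | _ | _ | _ | _ | ⟨⟨_, _⟩⟩ | ⟨⟨_, _⟩, ⟨_, _⟩⟩ |
      ⟨_ | _, ⟨_, _⟩⟩ | ⟨⟨_, _⟩⟩ | ⟨⟨_, _⟩⟩ | ⟨⟨_, _⟩⟩ | ⟨⟨_, _⟩⟩ | ⟨⟨_, _⟩⟩ <;>
      simp at h ⊢ <;> omega
  lo
    | .c₁c₂ => .c₂ | .c₃b i => .b i | .bm i j => .m i j | .mc₄ _ _ => .c₄
    | .spokeFst .d₁c₂ j => .spoke .d₁c₂ j | .spokeFst .d₁c₄ _ => .d₁ | .spokeFst .d₂c₁ _ => .d₂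
    | .spokeFst .d₂c₃ j => .spoke .d₂c₃ j | .spokeFst .d₁d₂ _ => .d₁
    | .spokeSnd .d₁c₂ _ => .c₂ | .spokeSnd .d₁c₄ j => .spoke .d₁c₄ j
    | .spokeSnd .d₂c₁ j => .spoke .d₂c₁ j | .spokeSnd .d₂c₃ _ => .c₃
    | .spokeSnd .d₁d₂ j => .spoke .d₁d₂ j
    | .c₂p _ => .c₂ | .pq j => .p j | .qc₃ j => .q j
    | .c₄r _ => .c₄ | .rs j => .r j | .sc₁ j => .s j
  hi
    | .c₁c₂ => .c₁ | .c₃b _ => .c₃ | .bm i _ => .b i | .mc₄ i j => .m i j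
    | .spokeFst .d₁c₂ _ => .d₁ | .spokeFst .d₁c₄ j => .spoke .d₁c₄ j
    | .spokeFst .d₂c₁ j => .spoke .d₂c₁ j
    | .spokeFst .d₂c₃ _ => .d₂ | .spokeFst .d₁d₂ j => .spoke .d₁d₂ j
    | .spokeSnd .d₁c₂ j => .spoke .d₁c₂ j | .spokeSnd .d₁c₄ _ => .c₄ | .spokeSnd .d₂c₁ _ => .c₁
    | .spokeSnd .d₂c₃ j => .spoke .d₂c₃ j | .spokeSnd .d₁d₂ _ => .d₂
    | .c₂p j => .p j | .pq j => .q j | .qc₃ _ => .c₃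
    | .c₄r j => .r j | .rs j => .s j | .sc₁ _ => .c₁
  ends_eq ε := by
    rcases ε with _ | _ | _ | _ | ⟨_ | _, _⟩ | ⟨_ | _, _⟩ | _ | _ | _ | _ | _ | _ <;>
      simp [Edge.ends, Edge.src, Edge.tgt, Spoke.fst, Spoke.snd]
  lo_lt_hi ε := by
    rcases ε with _ | _ | _ | _ | ⟨_ | _, _⟩ | ⟨_ | _, _⟩ | _ | _ | _ | _ | _ | _ <;>
      simp [TripleLt]
  upper
    | .c₁c₂ | .bm _ _ | .spokeFst _ _ | .pq _ | .rs _ => true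
    | _ => false
  left ε := ∃ j, ε = .pq j
  right ε := ∃ j, ε = .rs j
  not_left_of_right := by rintro _ ⟨j, rfl⟩; simp
  interleave ε ε' hp h1 h2 h3 := by
    rcases ε with _ | ⟨⟨_, _⟩⟩ | ⟨⟨_, _⟩, ⟨_, _⟩⟩ | ⟨⟨_, _⟩, ⟨_, _⟩⟩ |
      ⟨_ | _, ⟨_, _⟩⟩ | ⟨_ | _, ⟨_, _⟩⟩ | ⟨⟨_, _⟩⟩ | ⟨⟨_, _⟩⟩ | ⟨⟨_, _⟩⟩ |
      ⟨⟨_, _⟩⟩ | ⟨⟨_, _⟩⟩ | ⟨⟨_, _⟩⟩ <;>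
    rcases ε' with _ | ⟨⟨_, _⟩⟩ | ⟨⟨_, _⟩, ⟨_, _⟩⟩ | ⟨⟨_, _⟩, ⟨_, _⟩⟩ |
      ⟨_ | _, ⟨_, _⟩⟩ | ⟨_ | _, ⟨_, _⟩⟩ | ⟨⟨_, _⟩⟩ | ⟨⟨_, _⟩⟩ | ⟨⟨_, _⟩⟩ |
      ⟨⟨_, _⟩⟩ | ⟨⟨_, _⟩⟩ | ⟨⟨_, _⟩⟩ <;>
      simp [TripleLt] at hp h1 h2 h3 ⊢ <;> omega

/-- In this order the only crossings are those between `c₁c₂` and the edges at `c₃`. -/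
def hubLayout (k ℓ : ℕ) : FanLayout k ℓ where
  key
    | .c₁ => (0, 0, 0) | .spoke .d₂c₁ j => (1, j, 0) | .d₂ => (2, 0, 0)
    | .spoke .d₁d₂ j => (3, j, 0) | .spoke .d₂c₃ j => (4, j, 0) | .c₃ => (5, 0, 0)
    | .q j => (6, j, 0) | .p j => (7, ℓ - j, 0) | .c₂ => (8, 0, 0)
    | .spoke .d₁c₂ j => (9, j, 0) | .d₁ => (10, 0, 0) | .spoke .d₁c₄ j => (11, j, 0)
    | .b i => (12, i, 0) | .m i j => (13, k - i, j) | .c₄ => (14, 0, 0)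
    | .r j => (15, j, 0) | .s j => (16, ℓ - j, 0) | .isolated t => (17, t, 0)
  key_injective u v h := by
    rcases u with _ | _ | _ | _ | _ | _ | ⟨⟨_, _⟩⟩ | ⟨⟨_, _⟩, ⟨_, _⟩⟩ |
      ⟨_ | _, ⟨_, _⟩⟩ | ⟨⟨_, _⟩⟩ | ⟨⟨_, _⟩⟩ | ⟨⟨_, _⟩⟩ | ⟨⟨_, _⟩⟩ | ⟨⟨_, _⟩⟩ <;>
    rcases v with _ | _ | _ | _ | _ | _ | ⟨⟨_, _⟩⟩ | ⟨⟨_, _⟩, ⟨_, _⟩⟩ |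
      ⟨_ | _, ⟨_, _⟩⟩ | ⟨⟨_, _⟩⟩ | ⟨⟨_, _⟩⟩ | ⟨⟨_, _⟩⟩ | ⟨⟨_, _⟩⟩ | ⟨⟨_, _⟩⟩ <;>
      simp at h ⊢ <;> omega
  lo
    | .c₁c₂ => .c₁ | .c₃b _ => .c₃ | .bm i _ => .b i | .mc₄ i j => .m i j
    | .spokeFst .d₁c₂ j => .spoke .d₁c₂ j | .spokeFst .d₁c₄ _ => .d₁
    | .spokeFst .d₂c₁ j => .spoke .d₂c₁ j | .spokeFst .d₂c₃ _ => .d₂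
    | .spokeFst .d₁d₂ j => .spoke .d₁d₂ j
    | .spokeSnd .d₁c₂ _ => .c₂ | .spokeSnd .d₁c₄ j => .spoke .d₁c₄ j
    | .spokeSnd .d₂c₁ _ => .c₁ | .spokeSnd .d₂c₃ j => .spoke .d₂c₃ j
    | .spokeSnd .d₁d₂ _ => .d₂
    | .c₂p j => .p j | .pq j => .q j | .qc₃ _ => .c₃
    | .c₄r _ => .c₄ | .rs j => .r j | .sc₁ _ => .c₁
  hi
    | .c₁c₂ => .c₂ | .c₃b i => .b i | .bm i j => .m i j | .mc₄ _ _ => .c₄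
    | .spokeFst .d₁c₂ _ => .d₁ | .spokeFst .d₁c₄ j => .spoke .d₁c₄ j
    | .spokeFst .d₂c₁ _ => .d₂ | .spokeFst .d₂c₃ j => .spoke .d₂c₃ j
    | .spokeFst .d₁d₂ _ => .d₁
    | .spokeSnd .d₁c₂ j => .spoke .d₁c₂ j | .spokeSnd .d₁c₄ _ => .c₄
    | .spokeSnd .d₂c₁ j => .spoke .d₂c₁ j | .spokeSnd .d₂c₃ _ => .c₃
    | .spokeSnd .d₁d₂ j => .spoke .d₁d₂ j
    | .c₂p _ => .c₂ | .pq j => .p j | .qc₃ j => .q j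
    | .c₄r j => .r j | .rs j => .s j | .sc₁ j => .s j
  ends_eq ε := by
    rcases ε with _ | _ | _ | _ | ⟨_ | _, _⟩ | ⟨_ | _, _⟩ | _ | _ | _ | _ | _ | _ <;>
      simp [Edge.ends, Edge.src, Edge.tgt, Spoke.fst, Spoke.snd]
  lo_lt_hi ε := by
    rcases ε with _ | _ | _ | _ | ⟨_ | _, _⟩ | ⟨_ | _, _⟩ | _ | _ | _ | _ | _ | _ <;>
      simp [TripleLt]
  upper
    | .bm _ _ | .spokeFst .d₁d₂ _ | .spokeSnd .d₁c₂ _ | .spokeSnd .d₁c₄ _ | .spokeSnd .d₂c₁ _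
    | .spokeSnd .d₂c₃ _ | .pq _ | .rs _ => false
    | _ => true
  left ε := ε = .c₁c₂
  right ε := ∃ i, ε = .c₃b i
  not_left_of_right := by rintro _ ⟨i, rfl⟩; simp
  interleave ε ε' hp h1 h2 h3 := by
    rcases ε with _ | ⟨⟨_, _⟩⟩ | ⟨⟨_, _⟩, ⟨_, _⟩⟩ | ⟨⟨_, _⟩, ⟨_, _⟩⟩ |
      ⟨_ | _, ⟨_, _⟩⟩ | ⟨_ | _, ⟨_, _⟩⟩ | ⟨⟨_, _⟩⟩ | ⟨⟨_, _⟩⟩ | ⟨⟨_, _⟩⟩ |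
      ⟨⟨_, _⟩⟩ | ⟨⟨_, _⟩⟩ | ⟨⟨_, _⟩⟩ <;>
    rcases ε' with _ | ⟨⟨_, _⟩⟩ | ⟨⟨_, _⟩, ⟨_, _⟩⟩ | ⟨⟨_, _⟩, ⟨_, _⟩⟩ |
      ⟨_ | _, ⟨_, _⟩⟩ | ⟨_ | _, ⟨_, _⟩⟩ | ⟨⟨_, _⟩⟩ | ⟨⟨_, _⟩⟩ | ⟨⟨_, _⟩⟩ |
      ⟨⟨_, _⟩⟩ | ⟨⟨_, _⟩⟩ | ⟨⟨_, _⟩⟩ <;>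
      simp [TripleLt] at hp h1 h2 h3 ⊢ <;> omega

theorem Edge.mem_sym2 {φ : V ≃ Vtx k ℓ} {ε : Edge k ℓ} {a : V} :
    a ∈ ε.sym2 φ ↔ φ a = ε.src ∨ φ a = ε.tgt := by
  simp [Edge.sym2, Equiv.eq_symm_apply]

theorem isKFanCrossingFree_bundleLayout (hk : 2 ≤ k) :
    ((bundleLayout k ℓ).drawing φ).IsKFanCrossingFree k := by
  rintro ⟨e, a, F, hF, h⟩
  obtain ⟨f, hf, f', hf', hne⟩ := Finset.one_lt_card.1 (hF ▸ hk : 1 < F.card)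
  obtain ⟨haf, p, hp⟩ := h f hf
  obtain ⟨haf', p', hp'⟩ := h f' hf'
  obtain ⟨_, _, ⟨j₁, rfl⟩, ⟨j₂, rfl⟩, H⟩ := FanLayout.left_right_of_crossing φ _ hp
  obtain ⟨_, _, ⟨j₃, rfl⟩, ⟨j₄, rfl⟩, H'⟩ := FanLayout.left_right_of_crossing φ _ hp'
  apply hne
  rcases H with ⟨rfl, rfl⟩ | ⟨rfl, rfl⟩ <;> rcases H' with ⟨h1, rfl⟩ | ⟨rfl, h1⟩ <;>
    have h2 := Edge.sym2_injective φ h1 <;> rw [Edge.mem_sym2] at haf haf' <;>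
    simp only [Edge.src, Edge.tgt] at haf haf' <;> rcases haf with haf | haf <;>
    simp_all

theorem crossings_hubLayout_le : ((hubLayout k ℓ).drawing φ).crossings ≤ k := by
  set Γ := (hubLayout k ℓ).drawing φ with hΓ
  have hsub (i : Fin k) :
      {p | Γ.Crossing ((Edge.c₁c₂ : Edge k ℓ).sym2 φ) ((Edge.c₃b i).sym2 φ) p}.Subsingleton :=
    BookLayout.subsingleton_crossing _ _ _
  have : Γ.crossingSet ⊆
      ⋃ i, {p | Γ.Crossing ((Edge.c₁c₂ : Edge k ℓ).sym2 φ) ((Edge.c₃b i).sym2 φ) p} := by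
    rintro p ⟨e, f, h⟩
    obtain ⟨_, _, rfl, ⟨i, rfl⟩, ⟨rfl, rfl⟩ | ⟨rfl, rfl⟩⟩ := FanLayout.left_right_of_crossing φ _ h
    · exact mem_iUnion.2 ⟨i, h⟩
    · exact mem_iUnion.2 ⟨i, h.2.1, h.1, h.2.2.1.symm, h.2.2.2.2.1, h.2.2.2.1, h.2.2.2.2.2⟩
  have hfin (i : Fin k) := (hsub i).finite
  calc Γ.crossings ≤ _ := ncard_le_ncard this (finite_iUnion hfin)
    _ ≤ ∑ i, {p | Γ.Crossing ((Edge.c₁c₂ : Edge k ℓ).sym2 φ) ((Edge.c₃b i).sym2 φ) p}.ncard :=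
        ncard_iUnion_le_of_fintype _
    _ ≤ ∑ _i : Fin k, 1 := Finset.sum_le_sum fun i _ =>
        have := (hfin i).to_subtype
        ncard_le_one_iff_subsingleton.2 (hsub i)
    _ = k := by simp

end FanGraph

namespace Drawing

variable {V : Type} {G : SimpleGraph V} (Γ : Drawing G)

theorem Crossing.symm {Γ : Drawing G} {e f : Sym2 V} {p : ℝ × ℝ} (h : Γ.Crossing e f p) :
    Γ.Crossing f e p :=
  ⟨h.2.1, h.1, h.2.2.1.symm, h.2.2.2.2.1, h.2.2.2.1, h.2.2.2.2.2⟩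

theorem Crosses.symm {Γ : Drawing G} {e f : Sym2 V} (h : Γ.Crosses e f) : Γ.Crosses f e :=
  h.imp fun _ => Crossing.symm

theorem mem_of_vpos_mem_img {e : Sym2 V} (he : e ∈ G.edgeSet) {w : V} (h : Γ.vpos w ∈ Γ.img e) :
    w ∈ e := by
  induction e with | h u v =>
  obtain ⟨t, ht, hw⟩ := h
  rcases eq_or_lt_of_le ht.1 with rfl | h0
  · rw [Γ.arc_start u v he] at hw
    exact Sym2.mem_iff.2 (Or.inl (Γ.vpos_inj hw).symm)
  rcases eq_or_lt_of_le ht.2 with rfl | h1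
  · rw [Γ.arc_end u v he] at hw
    exact Sym2.mem_iff.2 (Or.inr (Γ.vpos_inj hw).symm)
  · exact absurd ⟨w, hw.symm⟩ (Γ.arc_avoids u v he t ⟨h0, h1⟩)

theorem crosses_of_disjoint {e f : Sym2 V} (he : e ∈ G.edgeSet) (hf : f ∈ G.edgeSet)
    (hd : ∀ w ∈ e, w ∉ f) {p : ℝ × ℝ} (hpe : p ∈ Γ.img e) (hpf : p ∈ Γ.img f) :
    Γ.Crosses e f := by
  refine ⟨p, he, hf, ?_, hpe, hpf, ?_⟩
  · rintro rfl
    induction e with | h u v => exact hd u (by simp) (by simp)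
  · rintro ⟨w, rfl⟩
    exact hd w (Γ.mem_of_vpos_mem_img he hpe) (Γ.mem_of_vpos_mem_img hf hpf)

theorem eq_of_crossing_of_mem_img {e f g : Sym2 V} {p : ℝ × ℝ} (h : Γ.Crossing e f p)
    (h' : Γ.Crossing e g p) : f = g := by
  obtain ⟨he, hf, hef, hpe, hpf, hp⟩ := h
  obtain ⟨-, hg, heg, -, hpg, -⟩ := h'
  by_contra hfg
  induction e with | h u₁ v₁ =>
  induction f with | h u₂ v₂ =>
  induction g with | h u₃ v₃ =>
  exact Γ.no_triple_point p hp u₁ v₁ u₂ v₂ u₃ v₃ he hf hg hef heg hfg ⟨hpe, hpf, hpg⟩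

theorem finite_crossingSet [Finite V] : Γ.crossingSet.Finite := by
  have : Γ.crossingSet = ⋃ x : Sym2 V × Sym2 V, {p | Γ.Crossing x.1 x.2 p} := by
    ext p
    simp [crossingSet]
  rw [this]
  refine finite_iUnion fun ⟨e, f⟩ => ?_
  induction e with | h u v =>
  induction f with | h w z =>
  by_cases h : G.Adj u v ∧ G.Adj w z ∧ s(u, v) ≠ s(w, z)
  · exact (Γ.inter_finite u v w z h.1 h.2.1 h.2.2).subset fun p hp => ⟨hp.2.2.2.1, hp.2.2.2.2.1⟩
  · convert finite_empty
    exact eq_empty_of_forall_notMem fun p hp => h ⟨hp.1, hp.2.1, hp.2.2.1⟩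

theorem exists_path_range_eq {u v : V} (h : G.Adj u v) :
    ∃ γ : Path (Γ.vpos u) (Γ.vpos v), range γ = Γ.img s(u, v) := by
  refine ⟨⟨⟨fun t => Γ.arc u v t, (Γ.arc_cont u v h).comp_continuous (by fun_prop)
    fun t => t.2⟩, by simpa using Γ.arc_start u v h, by simpa using Γ.arc_end u v h⟩, ?_⟩
  change range (fun t : unitInterval => Γ.arc u v t) = Γ.arc u v '' Icc 0 1
  rw [image_eq_range]

open Classical in
theorem IsKFanCrossingFree.card_filter_crosses_lt {Γ : Drawing G} {k : ℕ}
    (hΓ : Γ.IsKFanCrossingFree k) (e : Sym2 V) (a : V) {α : Type} [Fintype α] {f : α → Sym2 V}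
    (hf : Function.Injective f) (ha : ∀ x, a ∈ f x) :
    (Finset.univ.filter fun x => Γ.Crosses e (f x)).card < k := by
  by_contra! h
  obtain ⟨F, hF, hc⟩ := Finset.exists_subset_card_eq h
  refine hΓ ⟨e, a, F.image f, (Finset.card_image_of_injective _ hf).trans hc, ?_⟩
  simp only [Finset.mem_image, forall_exists_index, and_imp, forall_apply_eq_imp_iff₂]
  exact fun x hx => ⟨ha x, (Finset.mem_filter.1 (hF hx)).2⟩

end Drawing

theorem exists_independent_paths_meet (a b : Fin 3 → ℝ × ℝ) (γ : ∀ i j, Path (a i) (b j)) :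
    ∃ i i' j j', i ≠ i' ∧ j ≠ j' ∧ (range (γ i j) ∩ range (γ i' j')).Nonempty := by
  let ψ := Complex.equivRealProdCLM.symm
  obtain ⟨i, i', j, j', hi, hj, s, t, h⟩ := exists_independent_curves_meet (fun i => ψ (a i))
    (fun j => ψ (b j)) (fun i j t => ψ ((γ i j).extend t))
    (fun i j => ψ.continuous.comp (γ i j).continuous_extend) (fun i j => by simp)
    (fun i j => by simp)
  refine ⟨i, i', j, j', hi, hj, (γ i j).extend s, ?_, ?_⟩
  · rw [← Path.extend_range]
    exact mem_range_self s
  · rw [ψ.injective h, ← Path.extend_range]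
    exact mem_range_self t

open Classical in
/-- Greedy choice of pairwise unrelated representatives, avoiding also a given finite set. -/
theorem exists_pairwise_unrelated_choice {ι α β : Type} [Fintype ι] [Fintype α] {R : β → β → Prop}
    (hR : ∀ ⦃g ε⦄, R g ε → R ε g) (rep : ι → α → Finset β) (base : Finset β) {N B : ℕ}
    (hrep : ∀ x t, (rep x t).card ≤ N)
    (hB : ∀ x g, (Finset.univ.filter fun t => ∃ ε ∈ rep x t, R g ε).card ≤ B)
    (h : (base.card + Fintype.card ι * N) * B < Fintype.card α) :
    ∃ t : ι → α, (∀ x, ∀ g ∈ base, ∀ ε ∈ rep x (t x), ¬ R g ε) ∧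
      ∀ x y, x ≠ y → ∀ ε ∈ rep x (t x), ∀ ε' ∈ rep y (t y), ¬ R ε ε' := by
  suffices H : ∀ s : Finset ι, ∃ t : ι → α, (∀ x ∈ s, ∀ g ∈ base, ∀ ε ∈ rep x (t x), ¬ R g ε) ∧
      ∀ x ∈ s, ∀ y ∈ s, x ≠ y → ∀ ε ∈ rep x (t x), ∀ ε' ∈ rep y (t y), ¬ R ε ε' by
    simpa using H Finset.univ
  intro s
  induction s using Finset.induction_on with
  | empty =>
    have : Nonempty α := Fintype.card_pos_iff.1 (by omega)
    exact ⟨fun _ => Classical.arbitrary α, by simp⟩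
  | insert x s hx ih =>
    obtain ⟨t, h1, h2⟩ := ih
    set S := base ∪ s.biUnion fun y => rep y (t y) with hS
    have hcard : S.card ≤ base.card + Fintype.card ι * N :=
      (Finset.card_union_le _ _).trans (Nat.add_le_add_left ((Finset.card_biUnion_le_card_mul _ _ N
        fun y _ => hrep y (t y)).trans (Nat.mul_le_mul_right _ (Finset.card_le_univ s))) _)
    obtain ⟨τ, hτ⟩ : ∃ τ, τ ∉ S.biUnion fun g =>
        Finset.univ.filter fun t => ∃ ε ∈ rep x t, R g ε := by
      by_contra! hall
      rw [← Finset.eq_univ_iff_forall] at hall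
      have := Finset.card_biUnion_le_card_mul S (fun g =>
        Finset.univ.filter fun t => ∃ ε ∈ rep x t, R g ε) B fun g _ => hB x g
      rw [hall, Finset.card_univ] at this
      have := Nat.mul_le_mul_right B hcard
      omega
    replace hτ : ∀ g ∈ S, ∀ ε ∈ rep x τ, ¬ R g ε := by simpa using hτ
    have hne {y : ι} (hy : y ∈ s) : Function.update t x τ y = t y :=
      Function.update_of_ne (ne_of_mem_of_not_mem hy hx) _ _
    have hold {y : ι} (hy : y ∈ s) : ∀ ε' ∈ rep y (t y), ∀ ε ∈ rep x τ, ¬ R ε' ε := fun ε' h' =>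
      hτ ε' (Finset.mem_union_right _ (Finset.mem_biUnion.2 ⟨y, hy, h'⟩))
    refine ⟨Function.update t x τ, fun y hy => ?_, fun y hy z hz hyz => ?_⟩
    · rcases Finset.mem_insert.1 hy with rfl | hy
      · rw [Function.update_self]
        exact fun g hg => hτ g (Finset.mem_union_left _ hg)
      · rw [hne hy]
        exact h1 y hy
    · rcases Finset.mem_insert.1 hy with rfl | hy' <;>
        rcases Finset.mem_insert.1 hz with rfl | hz'
      · exact absurd rfl hyz
      · rw [Function.update_self, hne hz']
        exact fun ε h ε' h' hR' => hold hz' ε' h' ε h (hR hR')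
      · rw [Function.update_self, hne hy']
        exact hold hy'
      · rw [hne hy', hne hz']
        exact h2 y hy' z hz' hyz

section FanGraph

variable {k ℓ : ℕ} {V : Type}

instance : Fintype Spoke :=
  ⟨⟨↑[Spoke.d₁c₂, .d₁c₄, .d₂c₁, .d₂c₃, .d₁d₂], by simp⟩, by rintro ⟨⟩ <;> simp⟩

namespace Edge

/-- The endpoint in `c₁, c₃, d₁` of the edge of `K₃,₃` whose bundle contains a given edge. -/
def row : Edge k ℓ → Fin 3
  | c₁c₂ | c₄r _ | rs _ | sc₁ _ | spokeFst .d₂c₁ _ | spokeSnd .d₂c₁ _ => 0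
  | c₃b _ | bm _ _ | mc₄ _ _ | c₂p _ | pq _ | qc₃ _ | spokeFst .d₂c₃ _ | spokeSnd .d₂c₃ _ => 1
  | _ => 2

/-- The endpoint in `c₂, c₄, d₂` of the edge of `K₃,₃` whose bundle contains a given edge. -/
def col : Edge k ℓ → Fin 3
  | c₁c₂ | c₂p _ | pq _ | qc₃ _ | spokeFst .d₁c₂ _ | spokeSnd .d₁c₂ _ => 0
  | c₃b _ | bm _ _ | mc₄ _ _ | c₄r _ | rs _ | sc₁ _ | spokeFst .d₁c₄ _ | spokeSnd .d₁c₄ _ => 1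
  | _ => 2

theorem row_eq_or_col_eq {ε ε' : Edge k ℓ} {x : Vtx k ℓ} (h : x = ε.src ∨ x = ε.tgt)
    (h' : x = ε'.src ∨ x = ε'.tgt) : ε.row = ε'.row ∨ ε.col = ε'.col := by
  rcases ε with _ | _ | _ | _ | ⟨_ | _, _⟩ | ⟨_ | _, _⟩ | _ | _ | _ | _ | _ | _ <;>
  rcases ε' with _ | _ | _ | _ | ⟨_ | _, _⟩ | ⟨_ | _, _⟩ | _ | _ | _ | _ | _ | _ <;>
    first
      | exact Or.inl rfl
      | exact Or.inr rfl
      | (rcases h with rfl | rfl <;> simp [src, tgt, Spoke.fst, Spoke.snd] at h')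

end Edge

variable {φ : V ≃ Vtx k ℓ} (Γ : Drawing (fanGraph φ))

/-- There is a curve between `x` and `y` along the drawing of the edges in `S`. -/
def Linked (S : Set (Edge k ℓ)) (x y : Vtx k ℓ) : Prop :=
  ∃ γ : Path (Γ.vpos (φ.symm x)) (Γ.vpos (φ.symm y)), range γ ⊆ ⋃ ε ∈ S, Γ.img (ε.sym2 φ)

variable {Γ}

theorem Linked.of_mem {S : Set (Edge k ℓ)} {ε : Edge k ℓ} (h : ε ∈ S) :
    Linked Γ S ε.src ε.tgt := by
  obtain ⟨γ, hγ⟩ := Γ.exists_path_range_eq (fanGraph_adj_symm φ ε)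
  exact ⟨γ, hγ.le.trans (subset_biUnion_of_mem (u := fun ε => Γ.img (ε.sym2 φ)) h)⟩

theorem Linked.symm {S : Set (Edge k ℓ)} {x y : Vtx k ℓ} (h : Linked Γ S x y) :
    Linked Γ S y x := by
  obtain ⟨γ, hγ⟩ := h
  exact ⟨γ.symm, by rwa [Path.symm_range]⟩

theorem Linked.trans {S : Set (Edge k ℓ)} {x y z : Vtx k ℓ} (h : Linked Γ S x y)
    (h' : Linked Γ S y z) : Linked Γ S x z := by
  obtain ⟨γ, hγ⟩ := h
  obtain ⟨γ', hγ'⟩ := h'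
  exact ⟨γ.trans γ', by rw [Path.trans_range]; exact union_subset hγ hγ'⟩

theorem exists_crosses_of_linked (T : Set (Edge k ℓ))
    (h : ∀ a b, Linked Γ {ε ∈ T | ε.row = a ∧ ε.col = b} (![.c₁, .c₃, .d₁] a)
      (![.c₂, .c₄, .d₂] b)) :
    ∃ ε ∈ T, ∃ ε' ∈ T, ε.row ≠ ε'.row ∧ ε.col ≠ ε'.col ∧ Γ.Crosses (ε.sym2 φ) (ε'.sym2 φ) := by
  choose γ hγ using h
  obtain ⟨a, a', b, b', ha, hb, p, hp, hp'⟩ := exists_independent_paths_meet _ _ γ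
  obtain ⟨ε, ⟨hε, rfl, rfl⟩, hm⟩ := mem_iUnion₂.1 (hγ _ _ hp)
  obtain ⟨ε', ⟨hε', rfl, rfl⟩, hm'⟩ := mem_iUnion₂.1 (hγ _ _ hp')
  refine ⟨ε, hε, ε', hε', ha, hb, Γ.crosses_of_disjoint (Edge.sym2_mem_edgeSet φ ε)
    (Edge.sym2_mem_edgeSet φ ε') (fun w hw hw' => ?_) hm hm'⟩
  rw [Edge.mem_sym2] at hw hw'
  exact (Edge.row_eq_or_col_eq hw hw').elim ha hb

/-- The `j`-th path of length three from `c₂` to `c₃`. -/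
def pqPath (j : Fin ℓ) : Set (Edge k ℓ) := {.c₂p j, .pq j, .qc₃ j}

/-- The `j`-th path of length three from `c₄` to `c₁`. -/
def rsPath (j : Fin ℓ) : Set (Edge k ℓ) := {.c₄r j, .rs j, .sc₁ j}

theorem eq_of_mem_pqPath {i j : Fin ℓ} {ε : Edge k ℓ} (h : ε ∈ pqPath i) (h' : ε ∈ pqPath j) :
    i = j := by
  rcases h with rfl | rfl | rfl <;> simpa [pqPath] using h'

theorem eq_of_mem_rsPath {i j : Fin ℓ} {ε : Edge k ℓ} (h : ε ∈ rsPath i) (h' : ε ∈ rsPath j) :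
    i = j := by
  rcases h with rfl | rfl | rfl <;> simpa [rsPath] using h'

theorem ne_of_mem_pqPath_of_mem_rsPath {i j : Fin ℓ} {ε ε' : Edge k ℓ} (h : ε ∈ pqPath i)
    (h' : ε' ∈ rsPath j) : ε ≠ ε' := by
  rcases h with rfl | rfl | rfl <;> rcases h' with rfl | rfl | rfl <;> simp

open Classical in
/-- The `j`-th path of length two in one of the bundles from `b i` to `c₄` and between the ends of
the spokes. -/
def bundlePath (i : Fin k) : Option Spoke → Fin ℓ → Finset (Edge k ℓ)
  | none, j => {.bm i j, .mc₄ i j}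
  | some x, j => {.spokeFst x j, .spokeSnd x j}

theorem card_bundlePath_le (i : Fin k) (x : Option Spoke) (j : Fin ℓ) :
    (bundlePath i x j).card ≤ 2 := by
  classical
  cases x <;> exact Finset.card_le_two

theorem row_eq_of_mem_bundlePath {i : Fin k} {x : Option Spoke} {j : Fin ℓ} {ε ε' : Edge k ℓ}
    (h : ε ∈ bundlePath i x j) (h' : ε' ∈ bundlePath i x j) : ε.row = ε'.row := by
  rcases x with _ | _ | _ <;>
    simp only [bundlePath, Finset.mem_insert, Finset.mem_singleton] at h h' <;>
    rcases h with rfl | rfl <;> rcases h' with rfl | rfl <;> rfl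

open Classical in
theorem card_filter_crosses_bundlePath_le (hΓ : Γ.IsKFanCrossingFree k) (i : Fin k)
    (x : Option Spoke) (g : Edge k ℓ) :
    (Finset.univ.filter fun j => ∃ ε ∈ bundlePath i x j,
      Γ.Crosses (g.sym2 φ) (ε.sym2 φ)).card ≤ 2 * (k - 1) := by
  have key (f f' : Fin ℓ → Edge k ℓ) (hf : Function.Injective f) (hf' : Function.Injective f')
      (a a' : Vtx k ℓ) (ha : ∀ j, a = (f j).src ∨ a = (f j).tgt)
      (ha' : ∀ j, a' = (f' j).src ∨ a' = (f' j).tgt) :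
      (Finset.univ.filter fun j => ∃ ε ∈ ({f j, f' j} : Finset (Edge k ℓ)),
        Γ.Crosses (g.sym2 φ) (ε.sym2 φ)).card ≤ 2 * (k - 1) := by
    simp only [Finset.mem_insert, Finset.mem_singleton, exists_eq_or_imp, exists_eq_left,
      Finset.filter_or]
    refine (Finset.card_union_le _ _).trans ?_
    have h1 := hΓ.card_filter_crosses_lt (g.sym2 φ) (φ.symm a)
      ((Edge.sym2_injective φ).comp hf) fun j => by simpa [Edge.mem_sym2] using ha j
    have h2 := hΓ.card_filter_crosses_lt (g.sym2 φ) (φ.symm a')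
      ((Edge.sym2_injective φ).comp hf') fun j => by simpa [Edge.mem_sym2] using ha' j
    simp only [Function.comp_apply] at h1 h2
    omega
  cases x with
  | none =>
    exact key (.bm i) (.mc₄ i) (fun _ _ h => by simpa using h) (fun _ _ h => by simpa using h)
      (.b i) .c₄ (fun _ => Or.inl rfl) fun _ => Or.inr rfl
  | some x =>
    exact key (.spokeFst x) (.spokeSnd x) (fun _ _ h => by simpa using h)
      (fun _ _ h => by simpa using h) x.fst x.snd (fun _ => Or.inl rfl) fun _ => Or.inr rfl

theorem exists_not_crosses_c₃b (hΓ : Γ.IsKFanCrossingFree k) :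
    ∃ i, ¬ Γ.Crosses ((Edge.c₁c₂ : Edge k ℓ).sym2 φ) ((Edge.c₃b i).sym2 φ) := by
  classical
  by_contra! h
  have := hΓ.card_filter_crosses_lt ((Edge.c₁c₂ : Edge k ℓ).sym2 φ) (φ.symm .c₃)
    (f := fun i => (Edge.c₃b i).sym2 φ)
    (fun i j h => by simpa using Edge.sym2_injective φ h) fun i => by simp [Edge.mem_sym2, Edge.src]
  simp [h] at this

theorem exists_crosses_pqPath_rsPath (hΓ : Γ.IsKFanCrossingFree k) (hℓ : 40 * (k - 1) < ℓ)
    (j j' : Fin ℓ) :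
    ∃ ε ∈ pqPath j, ∃ ε' ∈ rsPath j', Γ.Crosses (ε.sym2 φ) (ε'.sym2 φ) := by
  classical
  by_contra! hPQ
  obtain ⟨i, hi⟩ := exists_not_crosses_c₃b hΓ
  let base : Finset (Edge k ℓ) := [.c₁c₂, .c₃b i, .c₂p j, .pq j, .qc₃ j, .c₄r j', .rs j',
    .sc₁ j'].toFinset
  have hbase : base.card ≤ 8 := List.toFinset_card_le _
  obtain ⟨t, h1, h2⟩ := exists_pairwise_unrelated_choice
    (R := fun g ε : Edge k ℓ => Γ.Crosses (g.sym2 φ) (ε.sym2 φ)) (fun _ _ => Drawing.Crosses.symm)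
    (bundlePath i) base (card_bundlePath_le i) (card_filter_crosses_bundlePath_le hΓ i) (by
      have : Fintype.card (Option Spoke) = 6 := rfl
      rw [this, Fintype.card_fin]
      have := Nat.mul_le_mul_right (2 * (k - 1)) (Nat.add_le_add_right hbase (6 * 2))
      omega)
  set T : Set (Edge k ℓ) := {ε | ε ∈ base ∨ ∃ x, ε ∈ bundlePath i x (t x)} with hT
  have hspoke (x : Spoke) : Linked Γ {ε ∈ T | ε.row = (Edge.spokeFst (k := k) x (t (some x))).row ∧
      ε.col = (Edge.spokeFst (k := k) x (t (some x))).col} x.fst x.snd :=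
    .trans (.of_mem (ε := .spokeFst x (t (some x)))
        ⟨Or.inr ⟨some x, by simp [bundlePath]⟩, rfl, rfl⟩)
      (.of_mem (ε := .spokeSnd x (t (some x)))
        ⟨Or.inr ⟨some x, by simp [bundlePath]⟩, by cases x <;> rfl, by cases x <;> rfl⟩)
  obtain ⟨ε, hε, ε', hε', hrow, hcol, hc⟩ := exists_crosses_of_linked (Γ := Γ) T (by
    intro a b
    fin_cases a <;> fin_cases b
    · exact .of_mem (ε := .c₁c₂) ⟨by simp [hT, base], rfl, rfl⟩
    · exact .symm (.trans (.of_mem (ε := .c₄r j') ⟨by simp [hT, base], rfl, rfl⟩)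
        (.trans (.of_mem (ε := .rs j') ⟨by simp [hT, base], rfl, rfl⟩)
          (.of_mem (ε := .sc₁ j') ⟨by simp [hT, base], rfl, rfl⟩)))
    · exact (hspoke .d₂c₁).symm
    · exact .symm (.trans (.of_mem (ε := .c₂p j) ⟨by simp [hT, base], rfl, rfl⟩)
        (.trans (.of_mem (ε := .pq j) ⟨by simp [hT, base], rfl, rfl⟩)
          (.of_mem (ε := .qc₃ j) ⟨by simp [hT, base], rfl, rfl⟩)))
    · exact .trans (.of_mem (ε := .c₃b i) ⟨by simp [hT, base], rfl, rfl⟩)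
        (.trans (.of_mem (ε := .bm i (t none)) ⟨Or.inr ⟨none, by simp [bundlePath]⟩, rfl, rfl⟩)
          (.of_mem (ε := .mc₄ i (t none)) ⟨Or.inr ⟨none, by simp [bundlePath]⟩, rfl, rfl⟩))
    · exact (hspoke .d₂c₃).symm
    · exact hspoke .d₁c₂
    · exact hspoke .d₁c₄
    · exact hspoke .d₁d₂)
  rcases hε with hε | ⟨x, hx⟩ <;> rcases hε' with hε' | ⟨y, hy⟩
  · simp only [base, List.mem_toFinset, List.mem_cons, List.not_mem_nil, or_false] at hε hε'
    rcases hε with rfl | rfl | rfl | rfl | rfl | rfl | rfl | rfl <;>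
    rcases hε' with rfl | rfl | rfl | rfl | rfl | rfl | rfl | rfl <;>
      first
        | exact hrow rfl
        | exact hcol rfl
        | exact hi hc
        | exact hi hc.symm
        | (refine hPQ _ ?_ _ ?_ hc <;> (simp [pqPath, rsPath]; done))
        | (refine hPQ _ ?_ _ ?_ hc.symm <;> simp [pqPath, rsPath])
  · exact h1 y _ hε _ hy hc
  · exact h1 x _ hε' _ hx hc.symm
  · by_cases hxy : x = y
    · subst hxy
      exact hrow (row_eq_of_mem_bundlePath hx hy)
    · exact h2 x y hxy _ hx _ hy hc

theorem sq_le_crossings [Finite V] (hΓ : Γ.IsKFanCrossingFree k) (hℓ : 40 * (k - 1) < ℓ) :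
    ℓ ^ 2 ≤ Γ.crossings := by
  choose ε hε ε' hε' p hp using exists_crosses_pqPath_rsPath hΓ hℓ
  have hinj : Function.Injective fun x : Fin ℓ × Fin ℓ => p x.1 x.2 := by
    rintro ⟨i, i'⟩ ⟨j, j'⟩ h
    have hc := hp i i'
    have hc' := hp j j'
    simp only at h
    rw [← h] at hc'
    have hne (a b c d) : (ε a b).sym2 φ ≠ (ε' c d).sym2 φ := fun h =>
      ne_of_mem_pqPath_of_mem_rsPath (hε a b) (hε' c d) (Edge.sym2_injective φ h)
    have h1 := Γ.eq_of_crossing_of_mem_img hc.symm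
      ⟨hc.2.1, hc'.1, (hne _ _ _ _).symm, hc.2.2.2.2.1, hc'.2.2.2.1, hc.2.2.2.2.2⟩
    have h2 := Γ.eq_of_crossing_of_mem_img hc
      ⟨hc.1, hc'.2.1, hne _ _ _ _, hc.2.2.2.1, hc'.2.2.2.2.1, hc.2.2.2.2.2⟩
    rw [(Edge.sym2_injective φ).eq_iff] at h1 h2
    exact Prod.ext (eq_of_mem_pqPath (hε i i') (h1 ▸ hε j j'))
      (eq_of_mem_rsPath (hε' i i') (h2 ▸ hε' j j'))
  calc ℓ ^ 2 = (range fun x : Fin ℓ × Fin ℓ => p x.1 x.2).ncard := by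
        rw [← image_univ, ncard_image_of_injective _ hinj, ncard_univ]
        simp [sq]
    _ ≤ Γ.crossings := ncard_le_ncard (by rintro _ ⟨x, rfl⟩; exact ⟨_, _, hp x.1 x.2⟩)
        Γ.finite_crossingSet

end FanGraph

/-- For all `k ≥ 2` and `ℓ ≥ 18k² + 40k - 57` there exists a
`k`-fan-crossing-free simple graph on exactly `n = 9kℓ + 27ℓ + 3k + 10`
vertices with `cr_{k-fan-free}(G) ≥ ℓ²` and `cr(G) ≤ k` (hence the
`k`-fan-crossing-free crossing ratio is `Ω(n²/k³)`). -/
theorem k_fan_crossing_free_crossing_ratio_lower (k ℓ : ℕ) (hk : 2 ≤ k)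
    (hℓ : 18 * k ^ 2 + 40 * k - 57 ≤ ℓ) :
    ∃ G : SimpleGraph (Fin (9 * k * ℓ + 27 * ℓ + 3 * k + 10)),
      (∃ Γ : Drawing G, Γ.IsKFanCrossingFree k) ∧
      ℓ ^ 2 ≤ crNumRestricted G (fun Γ => Γ.IsKFanCrossingFree k) ∧
      crNum G ≤ k := by
  obtain ⟨φ⟩ := nonempty_fin_equiv_vtx k ℓ
  have hfree := isKFanCrossingFree_bundleLayout φ hk
  refine ⟨fanGraph φ, ⟨_, hfree⟩, ?_, ?_⟩
  · refine le_csInf ⟨_, _, hfree, rfl⟩ ?_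
    rintro _ ⟨Γ, hΓ, rfl⟩
    refine sq_le_crossings hΓ ?_
    have : 2 ^ 2 ≤ k ^ 2 := Nat.pow_le_pow_left hk 2
    omega
  · exact le_trans (Nat.sInf_le ⟨(hubLayout k ℓ).drawing φ, rfl⟩) (crossings_hubLayout_le φ)
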